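/- arXiv:math/0510387 — 6 statements merged into one kernel-verified Lean document; each statement's English description precedes it below -/
import Mathlib

section
/- Let G be a finite simple graph without isolated vertices. Then α(G) ≤ τ(G)·(1 + α(G) − σ_v(G)). -/
/-- A set of vertices is stable (independent) if no two of its vertices are adjacent. -/
def IsStable {V : Type*} (G : SimpleGraph V) (S : Set V) : Prop :=
  ∀ ⦃u⦄, u ∈ S → ∀ ⦃v⦄, v ∈ S → ¬ G.Adj u v

/-- A set of vertices is a vertex cover if it meets every edge. -/
def IsCover {V : Type*} (G : SimpleGraph V) (C : Set V) : Prop :=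
  ∀ ⦃u v⦄, G.Adj u v → u ∈ C ∨ v ∈ C

/-- The stability number α(G): the maximum size of a stable set. -/
noncomputable def alphaNum {V : Type*} (G : SimpleGraph V) : ℕ :=
  sSup {n | ∃ S : Set V, IsStable G S ∧ S.ncard = n}

/-- The vertex covering number τ(G): the minimum size of a vertex cover. -/
noncomputable def tauNum {V : Type*} (G : SimpleGraph V) : ℕ :=
  sInf {n | ∃ C : Set V, IsCover G C ∧ C.ncard = n}

/-- An inclusionwise maximal stable set. -/
def IsMaximalStable {V : Type*} (G : SimpleGraph V) (S : Set V) : Prop :=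
  IsStable G S ∧ ∀ T : Set V, IsStable G T → S ⊆ T → S = T

/-- The σ_v-cover number: the maximum m such that every vertex belongs to a
maximal stable set with at least m vertices. -/
noncomputable def sigmaV {V : Type*} (G : SimpleGraph V) : ℕ :=
  sSup {m | ∀ v : V, ∃ S : Set V, v ∈ S ∧ IsMaximalStable G S ∧ m ≤ S.ncard}

/-- α_core(G): the intersection of all maximum stable sets of G. -/
def alphaCore {V : Type*} (G : SimpleGraph V) : Set V :=
  {v | ∀ S : Set V, IsStable G S → S.ncard = alphaNum G → v ∈ S}

/-- τ_core(G): the intersection of all minimum vertex covers of G. -/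
def tauCore {V : Type*} (G : SimpleGraph V) : Set V :=
  {v | ∀ C : Set V, IsCover G C → C.ncard = tauNum G → v ∈ C}

lemma IsStable.ncard_le_alphaNum {V : Type*} [Finite V] {G : SimpleGraph V} {T : Set V}
    (hT : IsStable G T) : T.ncard ≤ alphaNum G := by
  refine le_csSup ⟨Nat.card V, ?_⟩ ⟨T, hT, rfl⟩
  rintro _ ⟨U, -, rfl⟩
  exact Set.ncard_le_card U

/-- The complement of a minimum vertex cover is a maximum stable set. -/
lemma exists_isCover_ncard_eq_tauNum {V : Type*} [Finite V] (G : SimpleGraph V) :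
    ∃ C : Set V, C.ncard = tauNum G ∧ IsStable G Cᶜ ∧ Cᶜ.ncard = alphaNum G := by
  obtain ⟨C, hC, hCn⟩ : tauNum G ∈ {n | ∃ C : Set V, IsCover G C ∧ C.ncard = n} :=
    Nat.sInf_mem ⟨_, Set.univ, fun _ _ _ => Or.inl trivial, rfl⟩
  have hS : IsStable G Cᶜ := fun u hu v hv h => (hC h).elim hu hv
  refine ⟨C, hCn, hS, le_antisymm hS.ncard_le_alphaNum (csSup_le ⟨_, Cᶜ, hS, rfl⟩ ?_)⟩
  rintro _ ⟨T, hT, rfl⟩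
  have hle : tauNum G ≤ Tᶜ.ncard := by
    refine Nat.sInf_le ⟨Tᶜ, fun u v h => ?_, rfl⟩
    by_contra! hn
    exact hT (not_not.1 hn.1) (not_not.1 hn.2) h
  have h₁ := Set.ncard_add_ncard_compl T
  have h₂ := Set.ncard_add_ncard_compl C
  omega

/-- Every vertex lies in a stable set with at least `sigmaV G` vertices. -/
lemma exists_isStable_sigmaV_le {V : Type*} [Finite V] (G : SimpleGraph V) (v : V) :
    ∃ T : Set V, v ∈ T ∧ IsStable G T ∧ sigmaV G ≤ T.ncard := by
  rcases Set.eq_empty_or_nonempty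
    {m | ∀ v : V, ∃ S : Set V, v ∈ S ∧ IsMaximalStable G S ∧ m ≤ S.ncard} with h | h
  · refine ⟨{v}, rfl, ?_, ?_⟩
    · rintro _ rfl _ rfl
      exact G.irrefl
    · simp [sigmaV, h]
  · have hb : BddAbove
        {m | ∀ v : V, ∃ S : Set V, v ∈ S ∧ IsMaximalStable G S ∧ m ≤ S.ncard} := by
      refine ⟨Nat.card V, fun m hm => ?_⟩
      obtain ⟨S, -, -, hS⟩ := hm v
      exact hS.trans (Set.ncard_le_card S)
    obtain ⟨T, hv, hT, hle⟩ := Nat.sSup_mem h hb v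
    exact ⟨T, hv, hT.1, hle⟩

/-- The vertices of `S` that have a neighbour in `A`. -/
def neighborsIn {V : Type*} (G : SimpleGraph V) (S A : Set V) : Set V :=
  {s | s ∈ S ∧ ∃ a ∈ A, G.Adj a s}

/-- Exchange argument: a stable set disjoint from a maximum stable set has at least as many
neighbours in it as it has elements. -/
lemma ncard_le_ncard_neighborsIn {V : Type*} [Finite V] {G : SimpleGraph V} {S B : Set V}
    (hS : IsStable G S) (hSn : S.ncard = alphaNum G) (hB : IsStable G B) (hd : Disjoint S B) :
    B.ncard ≤ (neighborsIn G S B).ncard := by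
  have hst : IsStable G (S \ neighborsIn G S B ∪ B) := by
    rintro u (hu | hu) v (hv | hv) h
    · exact hS hu.1 hv.1 h
    · exact hu.2 ⟨hu.1, v, hv, h.symm⟩
    · exact hv.2 ⟨hv.1, u, hu, h⟩
    · exact hB hu hv h
  have h₁ := hst.ncard_le_alphaNum
  rw [Set.ncard_union_eq (hd.mono_left Set.sdiff_subset)] at h₁
  have h₂ := Set.ncard_sdiff_add_ncard_of_subset (s := neighborsIn G S B) (t := S)
    (fun _ h => h.1)
  omega

/-- A set of vertices of `Sᶜ`, not all of it, whose number of neighbours in the maximum stable set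
`S` is suitably bounded can be enlarged keeping the bound. -/
lemma exists_ssuperset_ncard_neighborsIn_le {V : Type*} [Finite V] {G : SimpleGraph V}
    {S A : Set V} (hS : IsStable G S) (hSn : S.ncard = alphaNum G) (hA : A ⊆ Sᶜ)
    (hAn : (neighborsIn G S A).ncard ≤ A.ncard * (1 + alphaNum G - sigmaV G))
    {v : V} (hvS : v ∉ S) (hvA : v ∉ A) :
    ∃ A' ⊆ Sᶜ, A ⊂ A' ∧
      (neighborsIn G S A').ncard ≤ A'.ncard * (1 + alphaNum G - sigmaV G) := by
  obtain ⟨T, hvT, hT, hTn⟩ := exists_isStable_sigmaV_le G v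
  have hTα := hT.ncard_le_alphaNum
  set D := T \ S
  have hDT : D ⊆ T := Set.sdiff_subset
  refine ⟨A ∪ D, Set.union_subset hA fun x hx => hx.2,
    ⟨Set.subset_union_left, fun h => hvA (h (Or.inr ⟨hvT, hvS⟩))⟩, ?_⟩
  have hN : neighborsIn G S (A ∪ D) = neighborsIn G S A ∪ neighborsIn G S D := by
    ext x
    simp only [neighborsIn, Set.mem_union, Set.mem_ofPred_eq, or_and_right, exists_or, and_or_left]
  have hN_card := Set.ncard_union_add_ncard_inter (neighborsIn G S A) (neighborsIn G S D)
  have hinter : (A ∩ D).ncard ≤ (neighborsIn G S A ∩ neighborsIn G S D).ncard :=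
    (ncard_le_ncard_neighborsIn hS hSn (fun u hu w hw => hT (hDT hu.2) (hDT hw.2))
      (Set.disjoint_left.2 fun x hx hx' => hx'.2.2 hx)).trans <|
      Set.ncard_le_ncard fun x ⟨hx, a, ha, hax⟩ => ⟨⟨hx, a, ha.1, hax⟩, ⟨hx, a, ha.2, hax⟩⟩
  have hND : (neighborsIn G S D).ncard + (T ∩ S).ncard ≤ S.ncard := by
    rw [← Set.ncard_union_eq]
    · exact Set.ncard_le_ncard (Set.union_subset (fun x hx => hx.1) Set.inter_subset_right)
    · exact Set.disjoint_left.2 fun x ⟨_, a, ha, hax⟩ hx => hT (hDT ha) hx.1 hax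
  have hTS : (T ∩ S).ncard + D.ncard = T.ncard := Set.ncard_inter_add_ncard_sdiff_eq_ncard T S
  have hU := Set.ncard_union_add_ncard_inter A D
  have hpos : (A ∩ D).ncard < D.ncard :=
    Set.ncard_lt_ncard ⟨Set.inter_subset_right, fun h => hvA (h ⟨hvT, hvS⟩).1⟩
  obtain ⟨k, hk⟩ : ∃ k, alphaNum G = sigmaV G + k := Nat.exists_eq_add_of_le (by omega)
  have hm : 1 + alphaNum G - sigmaV G = k + 1 := by omega
  rw [hm] at hAn ⊢
  obtain ⟨d, hd⟩ : ∃ d, D.ncard = (A ∩ D).ncard + 1 + d := Nat.exists_eq_add_of_le (by omega)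
  have hAD : (A ∪ D).ncard = A.ncard + 1 + d := by omega
  rw [hN, hAD]
  have hle : (neighborsIn G S A ∪ neighborsIn G S D).ncard ≤ A.ncard * (k + 1) + k + 1 + d := by
    omega
  nlinarith [Nat.zero_le (d * k)]

/-- Let G be a finite simple graph without isolated vertices.
Then α(G) ≤ τ(G)·(1 + α(G) − σ_v(G)). -/
theorem stmt_0 {V : Type*} [Fintype V] (G : SimpleGraph V)
    (hiso : ∀ v : V, ∃ w, G.Adj v w) :
    alphaNum G ≤ tauNum G * (1 + alphaNum G - sigmaV G) := by
  obtain ⟨C, hCn, hS, hSn⟩ := exists_isCover_ncard_eq_tauNum G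
  obtain ⟨A, ⟨hAC, hA⟩, hmax⟩ := (Set.toFinite {A : Set V | A ⊆ Cᶜᶜ ∧
    (neighborsIn G Cᶜ A).ncard ≤ A.ncard * (1 + alphaNum G - sigmaV G)}).exists_maximal
    ⟨∅, Set.empty_subset _, by simp [neighborsIn]⟩
  have hCA : C ⊆ A := by
    intro v hv
    by_contra hvA
    obtain ⟨A', hA', hlt, hle⟩ :=
      exists_ssuperset_ncard_neighborsIn_le hS hSn hAC hA (not_not.2 hv) hvA
    exact hlt.2 (hmax ⟨hA', hle⟩ hlt.1)
  obtain rfl : A = C := Set.Subset.antisymm (by simpa using hAC) hCA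
  have hN : neighborsIn G Aᶜ A = Aᶜ := by
    refine Set.Subset.antisymm (fun x hx => hx.1) fun x hx => ⟨hx, ?_⟩
    obtain ⟨w, hw⟩ := hiso x
    exact ⟨w, by_contra fun h => hS hx h hw, hw.symm⟩
  rwa [hN, hSn, hCn] at hA
end

section
/- Let G be a finite simple graph. Then every neighbour of a vertex of α_core(G) belongs to τ_core(G), i.e. N(α_core(G)) ⊆ τ_core(G). -/
theorem IsStable.compl_isCover {V : Type*} {G : SimpleGraph V} {S : Set V}
    (hS : IsStable G S) : IsCover G Sᶜ := by
  intro u v huv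
  by_contra! h
  exact hS (not_not.mp h.1) (not_not.mp h.2) huv

theorem IsCover.compl_isStable {V : Type*} {G : SimpleGraph V} {C : Set V}
    (hC : IsCover G C) : IsStable G Cᶜ :=
  fun _ hu _ hv huv => (hC huv).elim hu hv

/-- The complement of a minimum vertex cover is a maximum stable set. -/
theorem IsCover.ncard_compl_eq_alphaNum {V : Type*} [Finite V] {G : SimpleGraph V} {C : Set V}
    (hC : IsCover G C) (hcard : C.ncard = tauNum G) : Cᶜ.ncard = alphaNum G := by
  symm
  apply IsGreatest.csSup_eq
  refine ⟨⟨Cᶜ, hC.compl_isStable, rfl⟩, ?_⟩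
  rintro _ ⟨S, hS, rfl⟩
  have hle : C.ncard ≤ Sᶜ.ncard := hcard.trans_le (Nat.sInf_le ⟨Sᶜ, hS.compl_isCover, rfl⟩)
  have hCadd := Set.ncard_add_ncard_compl C
  have hSadd := Set.ncard_add_ncard_compl S
  omega

/-- Every neighbour of a vertex of α_core(G) belongs to τ_core(G). -/
theorem stmt_2 {V : Type*} [Fintype V] (G : SimpleGraph V)
    (u w : V) (hu : u ∈ alphaCore G) (huw : G.Adj u w) :
    w ∈ tauCore G := by
  intro C hC hcard
  have huC : u ∉ C := hu Cᶜ hC.compl_isStable (hC.ncard_compl_eq_alphaNum hcard)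
  exact (hC huw).resolve_left huC
end

section
/- Let C be a minimum vertex cover of a finite simple graph G and let S ⊆ C be a stable set. Then |S| ≤ |N(S) \ C|, i.e. the number of vertices outside C adjacent to some vertex of S is at least |S|. -/
/-- A cover has at least τ(G) vertices. -/
theorem IsCover.tauNum_le {V : Type*} {G : SimpleGraph V} {C : Set V} (hC : IsCover G C) :
    tauNum G ≤ C.ncard :=
  Nat.sInf_le ⟨C, hC, rfl⟩

/-- Exchanging a stable set for its neighbours outside a cover gives a cover. -/
theorem IsCover.exchange {V : Type*} {G : SimpleGraph V} {C S : Set V} (hC : IsCover G C)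
    (hS : IsStable G S) : IsCover G ((C \ S) ∪ ({w | ∃ v ∈ S, G.Adj v w} \ C)) := by
  intro u v huv
  have hcov := hC huv
  have huS : u ∈ S → v ∉ S := fun hu hv => hS hu hv huv
  have hv : u ∈ S → ∃ x ∈ S, G.Adj x v := fun hu => ⟨u, hu, huv⟩
  have hu : v ∈ S → ∃ x ∈ S, G.Adj x u := fun hv => ⟨v, hv, huv.symm⟩
  grind

/-- Let C be a minimum vertex cover of G and let S ⊆ C be a stable set.
Then |S| ≤ |N(S) \ C|. -/
theorem stmt_10 {V : Type*} [Fintype V] (G : SimpleGraph V)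
    (C S : Set V) (hC : IsCover G C) (hCmin : C.ncard = tauNum G)
    (hSC : S ⊆ C) (hS : IsStable G S) :
    S.ncard ≤ ({w | ∃ v ∈ S, G.Adj v w} \ C).ncard := by
  have hle := (hC.exchange hS).tauNum_le
  have hunion := Set.ncard_union_le (C \ S) ({w | ∃ v ∈ S, G.Adj v w} \ C)
  have hsplit := Set.ncard_sdiff_add_ncard_of_subset hSC
  omega
end

section
/- Let a ≥ 1 and t ≥ 0 be natural numbers, and write a + t = r·a + s with 0 ≤ s < a (so r = ⌊(a+t)/a⌋ and s = (a+t) mod a). Then Γ(a,t) = (a − s)·C(r,2) + s·C(r+1,2), where C(n,2) denotes the binomial coefficient n choose 2. -/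
/-- Γ(a,t): the minimum of Σ C(z_i,2) over nonnegative z_1,…,z_a summing to a + t. -/
noncomputable def Gamma (a t : ℕ) : ℕ :=
  sInf {m | ∃ z : Fin a → ℕ, (∑ i, z i) = a + t ∧ (∑ i, Nat.choose (z i) 2) = m}

theorem two_mul_choose_two_add_self (n : ℕ) : 2 * n.choose 2 + n = n * n := by
  induction n with
  | zero => rfl
  | succ k ih =>
    have h : (k + 1).choose 2 = k.choose 1 + k.choose 2 := Nat.choose_succ_succ k 1
    rw [h, Nat.choose_one_right]
    linarith

/-- The chord of `n ↦ n.choose 2` through `r` and `r + 1` lies below its values at all naturals. -/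
theorem choose_two_add_mul_le (r z : ℕ) : r.choose 2 + r * z ≤ z.choose 2 + r * r := by
  have hr := two_mul_choose_two_add_self r
  have hz := two_mul_choose_two_add_self z
  rcases le_or_gt z r with h | h
  · obtain ⟨d, rfl⟩ := Nat.exists_eq_add_of_le h
    nlinarith
  · obtain ⟨d, rfl⟩ := Nat.exists_eq_add_of_lt h
    nlinarith

/-- Writing a + t = r·a + s with r = ⌊(a+t)/a⌋ and s = (a+t) mod a,
we have Γ(a,t) = (a − s)·C(r,2) + s·C(r+1,2). -/
theorem stmt_11 (a t : ℕ) (ha : 1 ≤ a) :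
    Gamma a t = (a - (a + t) % a) * Nat.choose ((a + t) / a) 2
      + ((a + t) % a) * Nat.choose ((a + t) / a + 1) 2 := by
  have hs : (a + t) % a < a := Nat.mod_lt _ ha
  have hdiv : a * ((a + t) / a) + (a + t) % a = a + t := Nat.div_add_mod _ _
  unfold Gamma
  generalize a + t = n at *
  generalize n / a = r at *
  generalize n % a = s at *
  have hsucc : (r + 1).choose 2 = r + r.choose 2 := by
    rw [Nat.choose_succ_succ r 1, Nat.choose_one_right]
  have hval : (a - s) * r.choose 2 + s * (r + 1).choose 2 = a * r.choose 2 + s * r := by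
    obtain ⟨d, rfl⟩ := Nat.exists_eq_add_of_le hs.le
    rw [Nat.add_sub_cancel_left, hsucc]
    ring
  have hcount : ∑ i : Fin a, (if (i : ℕ) < s then 1 else 0) = s := by
    rw [Finset.sum_boole, Fin.card_filter_val_lt, min_eq_right hs.le, Nat.cast_id]
  rw [hval]
  refine IsLeast.csInf_eq ⟨⟨fun i => r + if (i : ℕ) < s then 1 else 0, ?_, ?_⟩, ?_⟩
  · rw [Finset.sum_add_distrib, hcount]
    simpa using hdiv
  · have h (i : Fin a) : (r + if (i : ℕ) < s then 1 else 0).choose 2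
        = r.choose 2 + (if (i : ℕ) < s then 1 else 0) * r := by
      split_ifs <;> simp [hsucc, add_comm]
    simp_rw [h]
    rw [Finset.sum_add_distrib, ← Finset.sum_mul, hcount]
    simp
  · rintro m ⟨z, hz, rfl⟩
    have h := Finset.sum_le_sum fun i (_ : i ∈ Finset.univ) => choose_two_add_mul_le r (z i)
    simp only [Finset.sum_add_distrib, ← Finset.mul_sum, hz, Finset.sum_const, Finset.card_univ,
      Fintype.card_fin, smul_eq_mul] at h
    nlinarith
end

section
/- Let a ≥ 2 and t ≥ 1 be natural numbers. Then Γ(a,t) ≤ Γ(a−1,t), with equality if and only if t ≤ a − 1. -/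
theorem Gamma_le {a t : ℕ} (z : Fin a → ℕ) (hz : ∑ i, z i = a + t) :
    Gamma a t ≤ ∑ i, Nat.choose (z i) 2 :=
  Nat.sInf_le ⟨z, hz, rfl⟩

theorem exists_sum_choose_eq_Gamma {a : ℕ} (ha : 1 ≤ a) (t : ℕ) :
    ∃ z : Fin a → ℕ, (∑ i, z i) = a + t ∧ (∑ i, Nat.choose (z i) 2) = Gamma a t := by
  refine Nat.sInf_mem (s := {m | ∃ z : Fin a → ℕ, (∑ i, z i) = a + t ∧
    (∑ i, Nat.choose (z i) 2) = m}) ?_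
  exact ⟨_, Pi.single (⟨0, ha⟩ : Fin a) (a + t), by simp, rfl⟩

theorem le_choose_two_add_one (n : ℕ) : n ≤ Nat.choose n 2 + 1 := by
  cases n with
  | zero => simp
  | succ n =>
    cases n with
    | zero => simp
    | succ n =>
      rw [Nat.choose_succ_succ' (n + 1) 1, Nat.choose_one_right]
      omega

theorem le_Gamma {a : ℕ} (ha : 1 ≤ a) (t : ℕ) : t ≤ Gamma a t := by
  obtain ⟨z, hz, hm⟩ := exists_sum_choose_eq_Gamma ha t
  have h : ∑ i, z i ≤ ∑ i, (Nat.choose (z i) 2 + 1) :=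
    Finset.sum_le_sum fun i _ => le_choose_two_add_one (z i)
  simp only [Finset.sum_add_distrib, Finset.sum_const, Finset.card_univ, Fintype.card_fin,
    smul_eq_mul, mul_one] at h
  omega

theorem Gamma_eq_of_le {a t : ℕ} (ha : 1 ≤ a) (hta : t ≤ a) : Gamma a t = t := by
  refine le_antisymm ?_ (le_Gamma ha t)
  have hcard : ∑ i : Fin a, (if i.val < t then 1 else 0) = t := by
    rw [Fin.sum_univ_eq_sum_range (fun i => if i < t then 1 else 0) a, ← Finset.sum_filter,
      Finset.sum_const, smul_eq_mul, mul_one]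
    convert Finset.card_range t using 2
    ext i
    simp only [Finset.mem_filter, Finset.mem_range]
    omega
  have h := Gamma_le (t := t) (fun i : Fin a => 1 + if i.val < t then 1 else 0) (by
    rw [Finset.sum_add_distrib, hcard]
    simp)
  refine h.trans_eq ((Finset.sum_congr rfl fun i _ => ?_).trans hcard)
  split_ifs <;> simp

theorem Gamma_succ_le {a : ℕ} (ha : 1 ≤ a) (t : ℕ) : Gamma (a + 1) t ≤ Gamma a t := by
  obtain ⟨z, hz, hm⟩ := exists_sum_choose_eq_Gamma ha t
  have h := Gamma_le (t := t) (Fin.cons 1 z : Fin (a + 1) → ℕ) (by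
    simp only [Fin.sum_univ_succ, Fin.cons_zero, Fin.cons_succ, hz]
    omega)
  simpa [Fin.sum_univ_succ, hm] using h

theorem Gamma_succ_lt {a t : ℕ} (ha : 1 ≤ a) (hta : a < t) : Gamma (a + 1) t < Gamma a t := by
  obtain ⟨z, hz, hm⟩ := exists_sum_choose_eq_Gamma ha t
  obtain ⟨i, hi⟩ : ∃ i, 3 ≤ z i := by
    by_contra! hlt
    have h : ∑ i, z i ≤ ∑ _i : Fin a, 2 :=
      Finset.sum_le_sum fun i _ => Nat.le_of_lt_succ (hlt i)
    simp only [Finset.sum_const, Finset.card_univ, Fintype.card_fin, smul_eq_mul] at h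
    omega
  obtain ⟨k, hk⟩ := Nat.exists_eq_add_of_le' hi
  have hsum (f : ℕ → ℕ) : ∑ j, f (Function.update z i (k + 2) j) + f (z i) =
      ∑ j, f (z j) + f (k + 2) := by
    rw [← Finset.add_sum_erase _ _ (Finset.mem_univ i),
      ← Finset.add_sum_erase _ (fun j => f (z j)) (Finset.mem_univ i),
      Finset.sum_congr rfl fun j hj => by
        rw [Function.update_of_ne (Finset.ne_of_mem_erase hj)],
      Function.update_self]
    ring
  have hsize := hsum id
  have hcost := hsum fun n => n.choose 2
  have hchoose : (k + 3).choose 2 = k + 2 + (k + 2).choose 2 := by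
    rw [Nat.choose_succ_succ' (k + 2) 1, Nat.choose_one_right]
  simp only [id_eq] at hsize
  rw [hk] at hsize hcost
  have h := Gamma_le (t := t) (Fin.cons 2 (Function.update z i (k + 2)) : Fin (a + 1) → ℕ) (by
    simp only [Fin.sum_univ_succ, Fin.cons_zero, Fin.cons_succ]
    omega)
  simp only [Fin.sum_univ_succ, Fin.cons_zero, Fin.cons_succ, Nat.choose_self] at h
  omega

/-- For a ≥ 2 and t ≥ 1, Γ(a,t) ≤ Γ(a−1,t), with equality iff t ≤ a − 1. -/
theorem stmt_12 (a t : ℕ) (ha : 2 ≤ a) (ht : 1 ≤ t) :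
    Gamma a t ≤ Gamma (a - 1) t ∧ (Gamma a t = Gamma (a - 1) t ↔ t ≤ a - 1) := by
  obtain ⟨b, rfl⟩ : ∃ b, a = b + 1 := ⟨a - 1, by omega⟩
  have hb : 1 ≤ b := by omega
  rw [Nat.add_sub_cancel]
  refine ⟨Gamma_succ_le hb t, fun h => ?_, fun h => ?_⟩
  · by_contra! hbt
    exact (Gamma_succ_lt hb hbt).ne h
  · rw [Gamma_eq_of_le hb h, Gamma_eq_of_le (by omega) (by omega)]
end

section
/- Let G be a finite simple graph, let c(G) denote its number of connected components, and let |E(G)| denote its number of edges. Then |E(G)| + c(G) ≥ α(G) + Γ(α(G), τ(G)); equivalently, |E(G)| ≥ α(G) − c(G) + Γ(α(G), τ(G)). -/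
universe u

theorem two_mul_ncard_edgeSet {V : Type*} [Fintype V] (G : SimpleGraph V) [DecidableRel G.Adj] :
    2 * G.edgeSet.ncard = ∑ x, ∑ y, if G.Adj x y then 1 else 0 := by
  classical
  rw [← SimpleGraph.coe_edgeFinset, Set.ncard_coe_finset, ← G.sum_degrees_eq_twice_card_edges]
  refine Finset.sum_congr rfl fun x _ => ?_
  rw [← Finset.card_filter, ← SimpleGraph.card_neighborFinset_eq_degree]
  congr 1
  ext y
  simp

/-- Vertices joined in `G` are joined without the edge `xy`, or each of them is joined to a
different end of it. -/
theorem reachable_deleteEdges_singleton {V : Type*} (G : SimpleGraph V) (x y : V) {a b : V}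
    (hab : G.Reachable a b) :
    (G.deleteEdges {s(x, y)}).Reachable a b ∨
      ((G.deleteEdges {s(x, y)}).Reachable a x ∧ (G.deleteEdges {s(x, y)}).Reachable y b) ∨
      ((G.deleteEdges {s(x, y)}).Reachable a y ∧ (G.deleteEdges {s(x, y)}).Reachable x b) := by
  obtain ⟨p⟩ := hab
  induction p with
  | nil => exact Or.inl (SimpleGraph.Reachable.refl _)
  | @cons u v w h p ih =>
    by_cases he : s(u, v) = s(x, y)
    · rcases Sym2.eq_iff.1 he with ⟨rfl, rfl⟩ | ⟨rfl, rfl⟩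
      · rcases ih with h1 | h1 | h1
        · exact Or.inr (Or.inl ⟨SimpleGraph.Reachable.refl _, h1⟩)
        · exact Or.inr (Or.inl ⟨SimpleGraph.Reachable.refl _, h1.2⟩)
        · exact Or.inl h1.2
      · rcases ih with h1 | h1 | h1
        · exact Or.inr (Or.inr ⟨SimpleGraph.Reachable.refl _, h1⟩)
        · exact Or.inl h1.2
        · exact Or.inr (Or.inr ⟨SimpleGraph.Reachable.refl _, h1.2⟩)
    · have hadj : (G.deleteEdges {s(x, y)}).Adj u v :=
        (G.deleteEdges_adj).2 ⟨h, he⟩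
      rcases ih with h1 | h1 | h1
      · exact Or.inl (hadj.reachable.trans h1)
      · exact Or.inr (Or.inl ⟨hadj.reachable.trans h1.1, h1.2⟩)
      · exact Or.inr (Or.inr ⟨hadj.reachable.trans h1.1, h1.2⟩)

/-- Deleting an edge splits at most one connected component in two. -/
theorem card_connectedComponent_deleteEdges_singleton_le {V : Type*} [Fintype V]
    (G : SimpleGraph V) (x y : V) :
    Nat.card (G.deleteEdges {s(x, y)}).ConnectedComponent ≤ Nat.card G.ConnectedComponent + 1 := by
  classical
  rw [Nat.card_eq_fintype_card, Nat.card_eq_fintype_card, ← Finset.card_univ,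
    ← Finset.card_univ, ← Nat.sub_le_iff_le_add,
    ← Finset.card_erase_of_mem
      (Finset.mem_univ ((G.deleteEdges {s(x, y)}).connectedComponentMk x))]
  refine Finset.card_le_card_of_injOn
    (SimpleGraph.ConnectedComponent.map (SimpleGraph.Hom.ofLE (G.deleteEdges_le {s(x, y)})))
    (fun _ _ => Finset.mem_coe.2 (Finset.mem_univ _)) ?_
  intro c hc d hd hcd
  induction c using SimpleGraph.ConnectedComponent.ind with | _ a
  induction d using SimpleGraph.ConnectedComponent.ind with | _ b
  simp only [Finset.coe_erase, Finset.coe_univ, Set.mem_sdiff, Set.mem_univ, Set.mem_singleton_iff,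
    true_and, SimpleGraph.ConnectedComponent.eq] at hc hd
  rw [SimpleGraph.ConnectedComponent.map_mk, SimpleGraph.ConnectedComponent.map_mk,
    SimpleGraph.ConnectedComponent.eq] at hcd
  rw [SimpleGraph.ConnectedComponent.eq]
  rcases reachable_deleteEdges_singleton G x y hcd with h | h | h
  · exact h
  · exact absurd h.1 hc
  · exact absurd h.2.symm hd

theorem IsStable.of_deleteEdges_singleton {V : Type*} {G : SimpleGraph V} {x y : V} {S : Set V}
    (hS : IsStable (G.deleteEdges {s(x, y)}) S) (hxy : x ∉ S ∨ y ∉ S) : IsStable G S := by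
  intro u hu w hw huw
  refine hS hu hw ((G.deleteEdges_adj).2 ⟨huw, fun he => ?_⟩)
  rcases Sym2.eq_iff.1 he with ⟨rfl, rfl⟩ | ⟨rfl, rfl⟩ <;> tauto

/-- If `xv` and `xy` are edges whose deletion increases the stability number, then no set of
vertices avoiding `x` and `v` is joined to the rest of the graph by the single edge `xy`. -/
theorem false_of_isolated_critical_edge {V : Type*} [Fintype V] {G : SimpleGraph V} {a : ℕ}
    (hub : ∀ S : Finset V, IsStable G (S : Set V) → S.card ≤ a) {K : Set V} {x y v : V}
    (hxK : x ∉ K) (hyK : y ∈ K) (hvK : v ∉ K) (hxy : G.Adj x y)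
    (honly : ∀ u w, u ∉ K → w ∈ K → G.Adj u w → u = x ∧ w = y) {S T : Finset V}
    (hS : IsStable (G.deleteEdges {s(x, y)}) (S : Set V)) (hSa : a < S.card)
    (hT : IsStable (G.deleteEdges {s(x, v)}) (T : Set V)) (hTa : a < T.card) : False := by
  classical
  have hxT : x ∈ T := by
    by_contra h
    exact absurd (hub T (hT.of_deleteEdges_singleton (Or.inl (by simpa using h)))) (by omega)
  have hyv : y ≠ v := fun h => hvK (h ▸ hyK)
  have hyT : y ∉ T := by
    intro h
    refine hT (Finset.mem_coe.2 hxT) (Finset.mem_coe.2 h) ((G.deleteEdges_adj).2 ⟨hxy, ?_⟩)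
    intro he
    rcases Sym2.eq_iff.1 he with ⟨-, h2⟩ | ⟨-, h2⟩
    · exact hyv h2
    · exact hxy.ne h2.symm
  have hSadj : ∀ u w, u ∈ S → w ∈ S → G.Adj u w → s(u, w) = s(x, y) := by
    intro u w hu hw h
    by_contra he
    exact hS (Finset.mem_coe.2 hu) (Finset.mem_coe.2 hw) ((G.deleteEdges_adj).2 ⟨h, he⟩)
  have hTadj : ∀ u w, u ∈ T → w ∈ T → G.Adj u w → s(u, w) = s(x, v) := by
    intro u w hu hw h
    by_contra he
    exact hT (Finset.mem_coe.2 hu) (Finset.mem_coe.2 hw) ((G.deleteEdges_adj).2 ⟨h, he⟩)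
  have h1 : IsStable G (↑((T.filter (· ∉ K)).erase x ∪ S.filter (· ∈ K)) : Set V) := by
    intro u hu w hw h
    simp only [Finset.coe_union, Set.mem_union, Finset.mem_coe, Finset.mem_erase,
      Finset.mem_filter] at hu hw
    rcases hu with ⟨hu1, hu2, hu3⟩ | ⟨hu2, hu3⟩ <;> rcases hw with ⟨hw1, hw2, hw3⟩ | ⟨hw2, hw3⟩
    · rcases Sym2.eq_iff.1 (hTadj u w hu2 hw2 h) with ⟨h3, h4⟩ | ⟨h3, h4⟩
      · exact hu1 h3
      · exact hw1 h4
    · exact hu1 (honly u w hu3 hw3 h).1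
    · exact hw1 (honly w u hw3 hu3 h.symm).1
    · rcases Sym2.eq_iff.1 (hSadj u w hu2 hw2 h) with ⟨h3, h4⟩ | ⟨h3, h4⟩
      · exact hxK (h3 ▸ hu3)
      · exact hxK (h4 ▸ hw3)
  have h2 : IsStable G (↑(S.filter (· ∉ K) ∪ T.filter (· ∈ K)) : Set V) := by
    intro u hu w hw h
    simp only [Finset.coe_union, Set.mem_union, Finset.mem_coe, Finset.mem_filter] at hu hw
    rcases hu with ⟨hu2, hu3⟩ | ⟨hu2, hu3⟩ <;> rcases hw with ⟨hw2, hw3⟩ | ⟨hw2, hw3⟩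
    · rcases Sym2.eq_iff.1 (hSadj u w hu2 hw2 h) with ⟨h3, h4⟩ | ⟨h3, h4⟩
      · exact hw3 (h4 ▸ hyK)
      · exact hu3 (h3 ▸ hyK)
    · exact hyT ((honly u w hu3 hw3 h).2 ▸ hw2)
    · exact hyT ((honly w u hw3 hu3 h.symm).2 ▸ hu2)
    · rcases Sym2.eq_iff.1 (hTadj u w hu2 hw2 h) with ⟨h3, h4⟩ | ⟨h3, h4⟩
      · exact hxK (h3 ▸ hu3)
      · exact hxK (h4 ▸ hw3)
  have c1 := hub _ h1
  have c2 := hub _ h2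
  rw [Finset.card_union_of_disjoint, Finset.card_erase_of_mem (by simp [hxT, hxK])] at c1
  · rw [Finset.card_union_of_disjoint] at c2
    · have c3 := Finset.card_filter_add_card_filter_not (s := S) (· ∈ K)
      have c4 := Finset.card_filter_add_card_filter_not (s := T) (· ∈ K)
      have c5 : 0 < (T.filter (· ∉ K)).card := Finset.card_pos.2 ⟨x, by simp [hxT, hxK]⟩
      omega
    · rw [Finset.disjoint_left]
      simp +contextual
  · rw [Finset.disjoint_left]
    simp +contextual

/-- If `N` is the closed neighbourhood of a vertex and every component of `G - N` adjacent to `N`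
sends at least two edges to it, then deleting `N` lowers the number of edges plus the number of
components by at least `1 + (∑ x ∈ N, deg x) / 2`. -/
theorem sum_degree_add_le_of_two_le {V : Type*} [Fintype V] [DecidableEq V] (G : SimpleGraph V)
    [DecidableRel G.Adj] (v : V) (N : Finset V) (hN : ∀ x, x ∈ N ↔ x = v ∨ G.Adj v x)
    (htwo : ∀ (y : {x // x ∉ N}) (x : V), x ∈ N → G.Adj x y →
      ∃ (y' : {x // x ∉ N}) (x' : V), x' ∈ N ∧ G.Adj x' y' ∧ (x', y') ≠ (x, y) ∧
        (G.comap (Subtype.val : {x // x ∉ N} → V)).connectedComponentMk y' =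
          (G.comap (Subtype.val : {x // x ∉ N} → V)).connectedComponentMk y) :
    (∑ x ∈ N, G.degree x) + 2 * (G.comap (Subtype.val : {x // x ∉ N} → V)).edgeSet.ncard +
        2 * Nat.card (G.comap (Subtype.val : {x // x ∉ N} → V)).ConnectedComponent + 2 ≤
      2 * G.edgeSet.ncard + 2 * Nat.card G.ConnectedComponent := by
  classical
  set H := G.comap (Subtype.val : {x // x ∉ N} → V) with hH
  let A : Finset H.ConnectedComponent := Finset.univ.filter fun c =>
    ∃ (y : {x // x ∉ N}) (x : V), x ∈ N ∧ G.Adj x y ∧ H.connectedComponentMk y = c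
  let P : Finset (V × {x // x ∉ N}) := Finset.univ.filter fun p => p.1 ∈ N ∧ G.Adj p.1 p.2
  have hPA : 2 * A.card ≤ P.card := by
    rw [Finset.card_eq_sum_card_fiberwise (s := P) (t := A)
      (f := fun p => H.connectedComponentMk p.2)]
    · rw [mul_comm, ← smul_eq_mul]
      refine Finset.card_nsmul_le_sum _ _ _ fun c hc => ?_
      obtain ⟨y, x, hx, hxy, rfl⟩ := (Finset.mem_filter.1 hc).2
      obtain ⟨y', x', hx', hxy', hne, hc'⟩ := htwo y x hx hxy
      refine Finset.one_lt_card.2 ⟨(x', y'), ?_, (x, y), ?_, hne⟩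
      · exact Finset.mem_filter.2 ⟨by simp [P, hx', hxy'], hc'⟩
      · simp [P, hx, hxy]
    · intro p hp
      have hp' := (Finset.mem_filter.1 (Finset.mem_coe.1 hp)).2
      exact Finset.mem_coe.2 (Finset.mem_filter.2
        ⟨Finset.mem_univ _, p.2, p.1, hp'.1, hp'.2, rfl⟩)
  have hPsum : P.card = ∑ y : {x // x ∉ N}, ∑ x ∈ N, if G.Adj x y then 1 else 0 := by
    rw [Finset.card_filter, Fintype.sum_prod_type, Finset.sum_comm]
    refine Finset.sum_congr rfl fun y _ => ?_
    simp only [ite_and, Finset.sum_ite_mem, Finset.univ_inter]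
  have hsplit : ∀ f : V → ℕ, ∑ x, f x = (∑ x ∈ N, f x) + ∑ x : {x // x ∉ N}, f x := by
    intro f
    rw [← Finset.sum_add_sum_compl N, Finset.sum_subtype Nᶜ (p := (· ∉ N)) (by simp)]
  have hedge : (∑ x ∈ N, G.degree x) + P.card + 2 * H.edgeSet.ncard = 2 * G.edgeSet.ncard := by
    rw [two_mul_ncard_edgeSet G, two_mul_ncard_edgeSet H, hPsum, hsplit, add_assoc,
      ← Finset.sum_add_distrib]
    congr 1
    · refine Finset.sum_congr rfl fun x _ => ?_
      rw [← Finset.card_filter, ← SimpleGraph.card_neighborFinset_eq_degree]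
      congr 1
      ext y
      simp
    · refine Finset.sum_congr rfl fun y _ => ?_
      rw [hsplit]
      simp [G.adj_comm, hH]
  have hstay : ∀ (w u : V), G.Reachable w u → ∀ hw : w ∉ N, H.connectedComponentMk ⟨w, hw⟩ ∉ A →
      ∃ hu : u ∉ N, H.connectedComponentMk ⟨u, hu⟩ = H.connectedComponentMk ⟨w, hw⟩ := by
    rintro w u ⟨p⟩
    induction p with
    | nil => exact fun hw _ => ⟨hw, rfl⟩
    | @cons w t u h p ih =>
      intro hw hA
      have ht : t ∉ N := fun ht => hA (Finset.mem_filter.2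
        ⟨Finset.mem_univ _, ⟨w, hw⟩, t, ht, h.symm, rfl⟩)
      have hwt : H.connectedComponentMk ⟨t, ht⟩ = H.connectedComponentMk ⟨w, hw⟩ :=
        (SimpleGraph.ConnectedComponent.connectedComponentMk_eq_of_adj
          (show H.Adj ⟨w, hw⟩ ⟨t, ht⟩ from h)).symm
      obtain ⟨hu, hu'⟩ := ih ht (hwt ▸ hA)
      exact ⟨hu, hu'.trans hwt⟩
  have hB : (Finset.univ \ A).card + 1 ≤ Fintype.card G.ConnectedComponent := by
    rw [← Finset.card_univ,
      ← Finset.card_erase_add_one (Finset.mem_univ (G.connectedComponentMk v))]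
    refine Nat.add_le_add_right (Finset.card_le_card_of_injOn
      (SimpleGraph.ConnectedComponent.map (⟨Subtype.val, fun h => h⟩ : H →g G)) ?_ ?_) 1
    · intro c hc
      induction c using SimpleGraph.ConnectedComponent.ind with | _ w
      have hc' : H.connectedComponentMk w ∉ A := (Finset.mem_sdiff.1 (Finset.mem_coe.1 hc)).2
      refine Finset.mem_coe.2 (Finset.mem_erase.2 ⟨fun he => ?_, Finset.mem_univ _⟩)
      obtain ⟨hv, -⟩ := hstay w v (SimpleGraph.ConnectedComponent.eq.1 he) w.2 hc'
      exact hv ((hN v).2 (Or.inl rfl))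
    · intro c hc d hd he
      induction c using SimpleGraph.ConnectedComponent.ind with | _ w
      induction d using SimpleGraph.ConnectedComponent.ind with | _ u
      have hc' : H.connectedComponentMk w ∉ A := (Finset.mem_sdiff.1 (Finset.mem_coe.1 hc)).2
      obtain ⟨hu, hu'⟩ := hstay w u (SimpleGraph.ConnectedComponent.eq.1 he) w.2 hc'
      exact hu'.symm
  have hAB : (Finset.univ \ A).card + A.card = Fintype.card H.ConnectedComponent := by
    rw [Finset.card_sdiff_add_card_eq_card (Finset.subset_univ _), Finset.card_univ]
  rw [Nat.card_eq_fintype_card, Nat.card_eq_fintype_card]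
  omega

/-- A graph on `n` vertices with stability number `a` has at least as many edges as `a` disjoint
cliques on `n` vertices in total, up to the correction by the number of components. -/
theorem exists_sum_choose_two_le {V : Type u} [Fintype V] (G : SimpleGraph V) (a : ℕ)
    (hex : ∃ S : Finset V, IsStable G (S : Set V) ∧ S.card = a)
    (hub : ∀ S : Finset V, IsStable G (S : Set V) → S.card ≤ a) :
    ∃ z : Fin a → ℕ, ∑ i, z i = Fintype.card V ∧
      a + ∑ i, (z i).choose 2 ≤ G.edgeSet.ncard + Nat.card G.ConnectedComponent := by
  classical
  induction hm : Fintype.card V + G.edgeSet.ncard using Nat.strong_induction_on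
    generalizing V a with
  | _ m ih =>
  by_cases hcrit : ∃ x y, G.Adj x y ∧
      ∀ S : Finset V, IsStable (G.deleteEdges {s(x, y)}) (S : Set V) → S.card ≤ a
  · obtain ⟨x, y, hxy, hS⟩ := hcrit
    have hcard : (G.deleteEdges {s(x, y)}).edgeSet.ncard + 1 = G.edgeSet.ncard := by
      rw [SimpleGraph.edgeSet_deleteEdges]
      exact Set.ncard_sdiff_singleton_add_one ((G.mem_edgeSet).2 hxy) (Set.toFinite _)
    obtain ⟨S, hS1, hS2⟩ := hex
    obtain ⟨z, hz1, hz2⟩ := ih _ (by omega) (G.deleteEdges {s(x, y)}) a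
      ⟨S, fun u hu w hw h => hS1 hu hw (G.deleteEdges_le _ h), hS2⟩ hS rfl
    have := card_connectedComponent_deleteEdges_singleton_le G x y
    exact ⟨z, hz1, by omega⟩
  push Not at hcrit
  rcases isEmpty_or_nonempty V with hV | hV
  · obtain ⟨S, hS1, hS2⟩ := hex
    obtain rfl : a = 0 := by rw [← hS2, Finset.eq_empty_of_isEmpty S, Finset.card_empty]
    exact ⟨Fin.elim0, by simp, by simp⟩
  obtain ⟨v, hv⟩ := G.exists_minimal_degree_vertex
  let N : Finset V := insert v (G.neighborFinset v)
  have hN : ∀ x, x ∈ N ↔ x = v ∨ G.Adj v x := by simp [N]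
  have hNcard : N.card = G.degree v + 1 := by
    rw [Finset.card_insert_of_notMem (by simp), SimpleGraph.card_neighborFinset_eq_degree]
  -- a maximum stable set through `v`
  obtain ⟨S, hSv, hS, hSa⟩ : ∃ S : Finset V, v ∈ S ∧ IsStable G (S : Set V) ∧ S.card = a := by
    by_cases hd : ∃ x, G.Adj v x
    · obtain ⟨x, hvx⟩ := hd
      obtain ⟨T, hT, hTa⟩ := hcrit v x hvx
      have hmem : v ∈ T ∧ x ∈ T := by
        by_contra h
        have := hub T (hT.of_deleteEdges_singleton (by simpa using not_and_or.1 h))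
        omega
      have hst : IsStable G (↑(T.erase x) : Set V) := by
        refine IsStable.of_deleteEdges_singleton (x := v) (y := x) ?_ (Or.inr (by simp))
        intro u hu w hw
        exact hT (Finset.mem_of_mem_erase hu) (Finset.mem_of_mem_erase hw)
      have h1 := hub _ hst
      have h2 := Finset.card_erase_add_one hmem.2
      exact ⟨T.erase x, Finset.mem_erase.2 ⟨hvx.ne, hmem.1⟩, hst, by omega⟩
    · push Not at hd
      obtain ⟨S, hS, hSa⟩ := hex
      by_cases hvS : v ∈ S
      · exact ⟨S, hvS, hS, hSa⟩
      · have hst : IsStable G (↑(insert v S) : Set V) := by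
          intro u hu w hw h
          rcases Finset.mem_insert.1 (Finset.mem_coe.1 hu) with rfl | hu
          · exact hd _ h
          rcases Finset.mem_insert.1 (Finset.mem_coe.1 hw) with rfl | hw
          · exact hd _ h.symm
          exact hS hu hw h
        have h1 := hub _ hst
        rw [Finset.card_insert_of_notMem hvS] at h1
        omega
  obtain ⟨b, rfl⟩ : ∃ b, a = b + 1 :=
    ⟨a - 1, by have := Finset.card_pos.2 ⟨v, hSv⟩; omega⟩
  have hmain := sum_degree_add_le_of_two_le G v N hN (by
    intro y x hx hxy
    by_contra! hno
    have hvx : G.Adj v x := by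
      rcases (hN x).1 hx with rfl | h
      · exact absurd ((hN y).2 (Or.inr hxy)) y.2
      · exact h
    obtain ⟨S', hS', hSa'⟩ := hcrit x y hxy
    obtain ⟨T', hT', hTa'⟩ := hcrit x v hvx.symm
    refine false_of_isolated_critical_edge hub (v := v) (x := x) (y := y)
      (K := {w | ∃ h : w ∉ N, (G.comap (Subtype.val : {x // x ∉ N} → V)).connectedComponentMk
        ⟨w, h⟩ = (G.comap (Subtype.val : {x // x ∉ N} → V)).connectedComponentMk y})
      (fun h => h.1 hx) ⟨y.2, rfl⟩ (fun h => h.1 ((hN v).2 (Or.inl rfl))) hxy ?_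
      hS' hSa' hT' hTa'
    rintro u w hu ⟨hw, hwy⟩ huw
    by_cases huN : u ∈ N
    · by_contra hne
      refine hno ⟨w, hw⟩ u huN huw (fun he => hne ?_) hwy
      have h1 := congrArg Prod.fst he
      have h2 := congrArg (fun p => (p.2 : V)) he
      exact ⟨h1, h2⟩
    · refine absurd ⟨huN, ?_⟩ hu
      rw [← hwy]
      exact SimpleGraph.ConnectedComponent.connectedComponentMk_eq_of_adj
        (show (G.comap (Subtype.val : {x // x ∉ N} → V)).Adj ⟨u, huN⟩ ⟨w, hw⟩ from huw))
  have hdeg : (G.degree v + 1) * G.degree v ≤ ∑ x ∈ N, G.degree x := by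
    rw [← hNcard, ← smul_eq_mul]
    exact Finset.card_nsmul_le_sum _ _ _ fun x _ => hv ▸ G.minDegree_le_degree x
  have hch : 2 * (G.degree v + 1).choose 2 = (G.degree v + 1) * G.degree v := by
    have h := (Nat.even_mul_succ_self (G.degree v)).two_dvd
    rw [mul_comm] at h
    rw [Nat.choose_two_right, Nat.add_sub_cancel]
    exact Nat.mul_div_cancel' h
  have hcardH : Fintype.card {x // x ∉ N} + (G.degree v + 1) = Fintype.card V := by
    have h1 : Fintype.card {x // x ∈ N} = N.card := Fintype.card_coe N
    have h2 := Fintype.card_subtype_compl (· ∈ N)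
    have h3 := Finset.card_le_univ N
    omega
  have hlt : (G.comap (Subtype.val : {x // x ∉ N} → V)).edgeSet.ncard ≤ G.edgeSet.ncard :=
    Nat.card_le_card_of_injective _ (SimpleGraph.Embedding.comap
      (Function.Embedding.subtype (· ∉ N)) G).mapEdgeSet.injective
  obtain ⟨z, hz1, hz2⟩ := ih _ (by omega) (G.comap (Subtype.val : {x // x ∉ N} → V)) b
    ⟨(S.erase v).subtype (· ∉ N), by
      intro u hu w hw
      simp only [Finset.mem_coe, Finset.mem_subtype, Finset.mem_erase] at hu hw
      exact hS hu.2 hw.2, by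
      rw [Finset.card_subtype, Finset.filter_true_of_mem, Finset.card_erase_of_mem hSv, hSa,
        Nat.add_sub_cancel]
      intro x hx hxN
      rw [Finset.mem_erase] at hx
      rcases (hN x).1 hxN with h | h
      · exact hx.1 h
      · exact hS hSv hx.2 h⟩ (by
      intro T hT
      have hvT : v ∉ T.map (Function.Embedding.subtype _) := by
        intro h
        obtain ⟨w, -, hw⟩ := Finset.mem_map.1 h
        exact w.2 ((hN w).2 (Or.inl hw))
      have h1 := hub (insert v (T.map (Function.Embedding.subtype _))) (by
        have hno : ∀ w ∈ T.map (Function.Embedding.subtype (· ∉ N)), ¬ G.Adj v w := by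
          intro w hw h
          obtain ⟨w', -, rfl⟩ := Finset.mem_map.1 hw
          exact w'.2 ((hN _).2 (Or.inr h))
        intro u hu w hw h
        rcases Finset.mem_insert.1 (Finset.mem_coe.1 hu) with rfl | hu
        · rcases Finset.mem_insert.1 (Finset.mem_coe.1 hw) with rfl | hw
          · exact G.irrefl h
          · exact hno w hw h
        rcases Finset.mem_insert.1 (Finset.mem_coe.1 hw) with rfl | hw
        · exact hno u hu h.symm
        obtain ⟨u', hu', rfl⟩ := Finset.mem_map.1 hu
        obtain ⟨w', hw', rfl⟩ := Finset.mem_map.1 hw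
        exact hT (Finset.mem_coe.2 hu') (Finset.mem_coe.2 hw') h)
      rw [Finset.card_insert_of_notMem hvT, Finset.card_map] at h1
      omega) rfl
  refine ⟨Fin.cons (G.degree v + 1) z, ?_, ?_⟩
  · rw [Fin.sum_univ_succ]
    simp only [Fin.cons_zero, Fin.cons_succ]
    omega
  · rw [Fin.sum_univ_succ]
    simp only [Fin.cons_zero, Fin.cons_succ]
    omega

/-- |E(G)| + c(G) ≥ α(G) + Γ(α(G), τ(G)). -/
theorem stmt_17 {V : Type*} [Fintype V] (G : SimpleGraph V) :
    alphaNum G + Gamma (alphaNum G) (tauNum G) ≤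
      G.edgeSet.ncard + Nat.card G.ConnectedComponent := by
  classical
  have hbdd : BddAbove {n | ∃ S : Set V, IsStable G S ∧ S.ncard = n} := by
    refine ⟨Fintype.card V, ?_⟩
    rintro n ⟨S, -, rfl⟩
    rw [← Nat.card_eq_fintype_card]
    exact Set.ncard_le_card S
  have hne : {n | ∃ S : Set V, IsStable G S ∧ S.ncard = n}.Nonempty :=
    ⟨0, ∅, fun u hu => absurd hu (Set.notMem_empty u), Set.ncard_empty V⟩
  obtain ⟨S, hS, hSa⟩ : ∃ S : Set V, IsStable G S ∧ S.ncard = alphaNum G := Nat.sSup_mem hne hbdd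
  have hub : ∀ S : Set V, IsStable G S → S.ncard ≤ alphaNum G := fun S hS =>
    le_csSup hbdd ⟨S, hS, rfl⟩
  have hcompl : ∀ C : Set V, C.ncard + Cᶜ.ncard = Fintype.card V := fun C => by
    rw [← Nat.card_eq_fintype_card]
    exact Set.ncard_add_ncard_compl C
  have hSc : IsCover G Sᶜ := by
    intro u w h
    by_contra! hno
    exact hS (not_not.1 hno.1) (not_not.1 hno.2) h
  obtain ⟨C, hC, hCt⟩ : ∃ C : Set V, IsCover G C ∧ C.ncard = tauNum G :=
    Nat.sInf_mem (s := {n | ∃ C : Set V, IsCover G C ∧ C.ncard = n}) ⟨_, Sᶜ, hSc, rfl⟩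
  have htau : alphaNum G + tauNum G = Fintype.card V := by
    have h1 : tauNum G ≤ Sᶜ.ncard := Nat.sInf_le ⟨Sᶜ, hSc, rfl⟩
    have h2 := hub Cᶜ (by
      intro u hu w hw h
      rcases hC h with h | h
      · exact hu h
      · exact hw h)
    have h3 := hcompl S
    have h4 := hcompl C
    omega
  obtain ⟨z, hz1, hz2⟩ := exists_sum_choose_two_le G (alphaNum G)
    ⟨S.toFinset, by simpa using hS, by rw [← hSa, Set.ncard_eq_toFinset_card']⟩
    (fun S hS => by simpa using hub S hS)
  have hG : Gamma (alphaNum G) (tauNum G) ≤ ∑ i, (z i).choose 2 :=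
    Nat.sInf_le ⟨z, hz1.trans htau.symm, rfl⟩
  omega
end
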